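/- arXiv:2209.15300 — 5 statements merged into one kernel-verified Lean document; each statement's English description precedes it below -/
import Mathlib

section
/- Let b > 1 and c > 0 be real constants, and suppose that the sequence [1, ⌈c·d(s,t)⌉] of exploration steps (with ⌈c·d(s,t)⌉ ≤ d(s,t)) is b-expanding from s. Then c·d(s,t) ≤ log_b(2m) + 1. -/
open Finset

section Defs

variable {V : Type*} [Fintype V]

/-- The degree of vertex `u` in `G`. -/
noncomputable def deg (G : SimpleGraph V) (u : V) : ℕ := Nat.card (G.neighborSet u)

/-- The number `m` of edges of `G`. -/
noncomputable def edgeCount (G : SimpleGraph V) : ℕ := Nat.card G.edgeSet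

/-- The BFS layer `ℓ(v, i)`: vertices at distance exactly `i` from `v`. -/
noncomputable def layer (G : SimpleGraph V) (v : V) (i : ℕ) : Finset V :=
  Finset.univ.filter fun u => G.dist v u = i

/-- Exploration cost `c_s(i)` of exploration step `i` from `s`. -/
noncomputable def costS (G : SimpleGraph V) (s : V) (i : ℕ) : ℕ :=
  ∑ u ∈ layer G s (i - 1), deg G u

/-- Exploration cost `c_t(i)` of exploration step `i` from `t`
(for the start--destination pair `(s, t)`). -/
noncomputable def costT (G : SimpleGraph V) (s t : V) (i : ℕ) : ℕ :=
  ∑ u ∈ layer G t (G.dist s t - i), deg G u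

/-- Cost `c_s([i, j])` of the sequence of exploration steps `[i, j]` from `s`. -/
noncomputable def costSseq (G : SimpleGraph V) (s : V) (i j : ℕ) : ℕ :=
  ∑ k ∈ Finset.Icc i j, costS G s k

/-- Cost `c_t([i, j])` of the sequence of exploration steps `[i, j]` from `t`. -/
noncomputable def costTseq (G : SimpleGraph V) (s t : V) (i j : ℕ) : ℕ :=
  ∑ k ∈ Finset.Icc i j, costT G s t k

/-- The sequence of exploration steps `[i, j]` is `b`-expanding from `s`:
`c_s(k+1) ≥ b · c_s(k)` for every `k ∈ [i, j)`. -/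
def ExpandS (G : SimpleGraph V) (s : V) (b : ℝ) (i j : ℕ) : Prop :=
  ∀ k, i ≤ k → k < j → b * (costS G s k : ℝ) ≤ (costS G s (k + 1) : ℝ)

/-- The sequence of exploration steps `[i, j]` is `b`-expanding from `t`:
`c_t(k-1) ≥ b · c_t(k)` for every `k ∈ (i, j]`. -/
def ExpandT (G : SimpleGraph V) (s t : V) (b : ℝ) (i j : ℕ) : Prop :=
  ∀ k, i < k → k ≤ j → b * (costT G s t k : ℝ) ≤ (costT G s t (k - 1) : ℝ)

/-- `e = expan_s(b)`: the latest step such that `[1, e]` is `b`-expanding from `s`. -/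
def IsExpanS (G : SimpleGraph V) (s t : V) (b : ℝ) (e : ℕ) : Prop :=
  1 ≤ e ∧ e ≤ G.dist s t ∧ ExpandS G s b 1 e ∧
    ∀ e', e < e' → e' ≤ G.dist s t → ¬ ExpandS G s b 1 e'

/-- `e = expan_t(b)`: the smallest step such that `[e, d(s,t)]` is `b`-expanding from `t`. -/
def IsExpanT (G : SimpleGraph V) (s t : V) (b : ℝ) (e : ℕ) : Prop :=
  1 ≤ e ∧ e ≤ G.dist s t ∧ ExpandT G s t b e (G.dist s t) ∧
    ∀ e', 1 ≤ e' → e' < e → ¬ ExpandT G s t b e' (G.dist s t)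

/-- `cs = cheap_s(α)`: the latest step with `c_s([1, cs]) ≤ m^α`. -/
def IsCheapS (G : SimpleGraph V) (s t : V) (α : ℝ) (cs : ℕ) : Prop :=
  1 ≤ cs ∧ cs ≤ G.dist s t ∧
    (costSseq G s 1 cs : ℝ) ≤ (edgeCount G : ℝ) ^ α ∧
    ∀ j, cs < j → j ≤ G.dist s t →
      ¬ ((costSseq G s 1 j : ℝ) ≤ (edgeCount G : ℝ) ^ α)

/-- `ct = cheap_t(α)`: the smallest step with `c_t([ct, d(s,t)]) ≤ m^α`. -/
def IsCheapT (G : SimpleGraph V) (s t : V) (α : ℝ) (ct : ℕ) : Prop :=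
  1 ≤ ct ∧ ct ≤ G.dist s t ∧
    (costTseq G s t ct (G.dist s t) : ℝ) ≤ (edgeCount G : ℝ) ^ α ∧
    ∀ j, 1 ≤ j → j < ct →
      ¬ ((costTseq G s t j (G.dist s t) : ℝ) ≤ (edgeCount G : ℝ) ^ α)

/-- `B` bounds the expansion in every applicable exploration step between `s` and `t`:
no sequence of exploration steps is more than `B`-expanding from `s` or from `t`. -/
def ExpBound (G : SimpleGraph V) (s t : V) (B : ℝ) : Prop :=
  (∀ k, 1 ≤ k → k + 1 ≤ G.dist s t → (costS G s (k + 1) : ℝ) ≤ B * (costS G s k : ℝ)) ∧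
  (∀ k, 2 ≤ k → k ≤ G.dist s t → (costT G s t (k - 1) : ℝ) ≤ B * (costT G s t k : ℝ))

/-- `B` is the highest expansion between `s` and `t`: the smallest number such that
no sequence of exploration steps is more than `B`-expanding from `s` or from `t`. -/
def IsHighestExpansion (G : SimpleGraph V) (s t : V) (B : ℝ) : Prop :=
  ExpBound G s t B ∧ ∀ B', ExpBound G s t B' → B ≤ B'

/-- Meeting cost `M(k) = c_s([1, k]) + c_t([k+1, d(s,t)])` of the bidirectional BFS whose
forward search performs `k` exploration steps and whose backward search performs the rest. -/
noncomputable def meetCost (G : SimpleGraph V) (s t : V) (k : ℕ) : ℕ :=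
  costSseq G s 1 k + costTseq G s t (k + 1) (G.dist s t)

/-- `ρ = max{S₂, T₂} / min{S₁, T₁}` where `S₁ = expan_s`, `S₂ = cheap_t − expan_s − 1`,
`T₁ = d(s,t) − expan_t + 1`, `T₂ = expan_t − cheap_s − 1`, computed from
`d = d(s,t)`, `cs = cheap_s`, `ct = cheap_t`, `es = expan_s`, `et = expan_t`. -/
noncomputable def rho (d cs ct es et : ℕ) : ℝ :=
  max ((ct : ℝ) - es - 1) ((et : ℝ) - cs - 1) / min (es : ℝ) ((d : ℝ) - et + 1)

end Defs

lemma deg_eq_degree {V : Type*} [Fintype V] (G : SimpleGraph V) [DecidableRel G.Adj] (u : V) :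
    deg G u = G.degree u := by
  rw [deg, Nat.card_eq_fintype_card, SimpleGraph.card_neighborSet_eq_degree]

lemma edgeCount_eq_card_edgeFinset {V : Type*} [Fintype V] (G : SimpleGraph V)
    [Fintype G.edgeSet] : edgeCount G = #G.edgeFinset := by
  rw [edgeCount, Nat.card_eq_fintype_card, SimpleGraph.edgeFinset_card]

lemma costS_le_two_mul_edgeCount {V : Type*} [Fintype V] (G : SimpleGraph V) (s : V) (i : ℕ) :
    costS G s i ≤ 2 * edgeCount G := by
  classical
  calc costS G s i ≤ ∑ u, deg G u :=
        Finset.sum_le_sum_of_subset (Finset.subset_univ _)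
    _ = 2 * edgeCount G := by
        simp only [deg_eq_degree, edgeCount_eq_card_edgeFinset]
        exact G.sum_degrees_eq_twice_card_edges

lemma one_le_costS_one {V : Type*} [Fintype V] (G : SimpleGraph V) (hconn : G.Connected)
    {s t : V} (hst : s ≠ t) : 1 ≤ costS G s 1 := by
  classical
  have : Nontrivial V := ⟨s, t, hst⟩
  have hdeg : 1 ≤ deg G s := by
    rw [deg_eq_degree]
    exact hconn.preconnected.degree_pos_of_nontrivial s
  exact hdeg.trans (Finset.single_le_sum (f := deg G) (fun _ _ => Nat.zero_le _)
    (by simp [layer]))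

lemma ExpandS.pow_mul_le {V : Type*} [Fintype V] {G : SimpleGraph V} {s : V} {b : ℝ} {i j : ℕ}
    (h : ExpandS G s b i j) (hb : 0 ≤ b) (n : ℕ) (hn : i + n ≤ j) :
    b ^ n * (costS G s i : ℝ) ≤ costS G s (i + n) := by
  induction n with
  | zero => simp
  | succ n ih =>
    calc b ^ (n + 1) * (costS G s i : ℝ) = b * (b ^ n * costS G s i) := by ring
      _ ≤ b * costS G s (i + n) := by gcongr; exact ih (by omega)
      _ ≤ costS G s (i + (n + 1)) := h (i + n) (by omega) (by omega)

/-- expanding sequences force logarithmic distance.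
If `[1, ⌈c · d(s,t)⌉]` (with `⌈c · d(s,t)⌉ ≤ d(s,t)`) is `b`-expanding from `s`
for constants `b > 1` and `c > 0`, then `c · d(s,t) ≤ log_b(2m) + 1`. -/
theorem stmt_1 {V : Type*} [Fintype V] (G : SimpleGraph V) (s t : V)
    (hconn : G.Connected) (hst : s ≠ t) (b c : ℝ) (hb : 1 < b) (hc : 0 < c)
    (hle : ⌈c * (G.dist s t : ℝ)⌉₊ ≤ G.dist s t)
    (hexp : ExpandS G s b 1 ⌈c * (G.dist s t : ℝ)⌉₊) :
    c * (G.dist s t : ℝ) ≤ Real.logb b (2 * (edgeCount G : ℝ)) + 1 := by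
  have hd : 0 < G.dist s t := hconn.pos_dist_of_ne hst
  obtain ⟨n, hn⟩ : ∃ n, ⌈c * (G.dist s t : ℝ)⌉₊ = 1 + n :=
    Nat.exists_eq_add_of_le (Nat.ceil_pos.mpr (by positivity))
  have hpow : b ^ n ≤ 2 * (edgeCount G : ℝ) :=
    calc b ^ n ≤ b ^ n * (costS G s 1 : ℝ) :=
          le_mul_of_one_le_right (by positivity) (by exact_mod_cast one_le_costS_one G hconn hst)
      _ ≤ costS G s (1 + n) := hexp.pow_mul_le (by positivity) n hn.ge
      _ ≤ 2 * (edgeCount G : ℝ) := by exact_mod_cast costS_le_two_mul_edgeCount G s (1 + n)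
  have hlog : (n : ℝ) ≤ Real.logb b (2 * (edgeCount G : ℝ)) := by
    rw [Real.le_logb_iff_rpow_le hb (lt_of_lt_of_le (by positivity) hpow), Real.rpow_natCast]
    exact hpow
  have hceil := Nat.le_ceil (c * (G.dist s t : ℝ))
  rw [hn] at hceil
  push_cast at hceil
  linarith
end

section
/- Let b > 1 be a real constant and suppose that s and t admit a b-expansion overlap, i.e., expan_t(b) ≤ expan_s(b). Then d(s,t) ≤ 2·(log_b(2m) + 1). -/
open Finset

/-- The degrees over any set of vertices sum to at most twice the number of edges. -/
theorem sum_deg_le_two_mul_edgeCount {V : Type*} [Fintype V] (G : SimpleGraph V)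
    (A : Finset V) : ∑ u ∈ A, deg G u ≤ 2 * edgeCount G := by
  classical
  calc ∑ u ∈ A, deg G u ≤ ∑ u, deg G u :=
        Finset.sum_le_sum_of_subset (Finset.subset_univ A)
    _ = ∑ u, G.degree u := by
        simp only [deg, Nat.card_eq_fintype_card, SimpleGraph.card_neighborSet_eq_degree]
    _ = 2 * edgeCount G := by
        rw [G.sum_degrees_eq_twice_card_edges, edgeCount, Nat.card_eq_fintype_card,
          SimpleGraph.edgeFinset_card]

/-- In a connected nontrivial graph the degree sum of the layer at distance zero is positive. -/
theorem one_le_sum_layer_zero {V : Type*} [Fintype V] [Nontrivial V] (G : SimpleGraph V)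
    (hconn : G.Connected) (v : V) : 1 ≤ ∑ u ∈ layer G v 0, deg G u := by
  classical
  have hv : v ∈ layer G v 0 := by simp [layer]
  have hdeg : 1 ≤ deg G v := by
    rw [deg, Nat.card_eq_fintype_card, SimpleGraph.card_neighborSet_eq_degree]
    exact hconn.preconnected.degree_pos_of_nontrivial v
  exact hdeg.trans (Finset.single_le_sum (f := deg G) (fun _ _ => Nat.zero_le _) hv)

/-- A sequence that starts at or above `1`, grows by a factor `b > 1` in each of `n` steps and
ends at or below `M` has `n ≤ log_b M`. -/
theorem le_logb_of_expanding {b M : ℝ} (hb : 1 < b) (f : ℕ → ℝ) (n : ℕ) (h0 : 1 ≤ f 0)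
    (hf : ∀ k < n, b * f k ≤ f (k + 1)) (hM : f n ≤ M) : (n : ℝ) ≤ Real.logb b M := by
  have hpow : ∀ k ≤ n, b ^ k ≤ f k := by
    intro k
    induction k with
    | zero => simpa using h0
    | succ k ih =>
      intro hk
      calc b ^ (k + 1) = b * b ^ k := pow_succ' b k
        _ ≤ b * f k := by gcongr; exact ih (by omega)
        _ ≤ f (k + 1) := hf k (by omega)
  have hle : b ^ n ≤ M := (hpow n le_rfl).trans hM
  have hpos : 0 < b ^ n := by positivity
  rw [Real.le_logb_iff_rpow_le hb (hpos.trans_le hle), Real.rpow_natCast]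
  exact hle

/-- an expansion overlap forces logarithmic distance.
Let `b > 1` and suppose `s` and `t` admit a `b`-expansion overlap, i.e.
`expan_t(b) ≤ expan_s(b)`. Then `d(s,t) ≤ 2 · (log_b(2m) + 1)`. -/
theorem stmt_4 {V : Type*} [Fintype V] (G : SimpleGraph V) (s t : V)
    (hconn : G.Connected) (hst : s ≠ t) (b : ℝ) (hb : 1 < b) (es et : ℕ)
    (hes : IsExpanS G s t b es) (het : IsExpanT G s t b et) (hoverlap : et ≤ es) :
    (G.dist s t : ℝ) ≤ 2 * (Real.logb b (2 * (edgeCount G : ℝ)) + 1) := by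
  have : Nontrivial V := ⟨s, t, hst⟩
  obtain ⟨hes1, -, hexpS, -⟩ := hes
  obtain ⟨-, hetd, hexpT, -⟩ := het
  have hS : ((es - 1 : ℕ) : ℝ) ≤ Real.logb b (2 * (edgeCount G : ℝ)) := by
    refine le_logb_of_expanding hb (fun k => (costS G s (k + 1) : ℝ)) _ ?_ ?_ ?_
    · exact_mod_cast one_le_sum_layer_zero G hconn s
    · exact fun k hk => hexpS (k + 1) (by omega) (by omega)
    · exact_mod_cast sum_deg_le_two_mul_edgeCount G _
  have hT : ((G.dist s t - et : ℕ) : ℝ) ≤ Real.logb b (2 * (edgeCount G : ℝ)) := by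
    refine le_logb_of_expanding hb (fun k => (costT G s t (G.dist s t - k) : ℝ)) _ ?_ ?_ ?_
    · have h := one_le_sum_layer_zero G hconn t
      simp only [costT, Nat.sub_zero, Nat.sub_self]
      exact_mod_cast h
    · intro k hk
      simpa only [Nat.sub_sub] using hexpT (G.dist s t - k) (by omega) (by omega)
    · exact_mod_cast sum_deg_le_two_mul_edgeCount G _
  have hd : (G.dist s t : ℝ) ≤ ((es - 1 : ℕ) : ℝ) + ((G.dist s t - et : ℕ) : ℝ) + 1 := by
    exact_mod_cast (by omega :
      G.dist s t ≤ (es - 1) + (G.dist s t - et) + 1)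
  linarith
end

section
/- Let 0 ≤ α < 1 and b⁺ > 1 be real constants. Suppose cheap_s(α) and cheap_t(α) are defined with cheap_s(α) < cheap_t(α), and suppose b⁺ is the highest expansion between s and t. Then there exists an exploration step k ∈ {0,...,d(s,t)} such that the meeting cost satisfies M(k) = c_s([1,k]) + c_t([k+1,d(s,t)]) ≤ 4·(b⁺/(b⁺−1))·m^α·(b⁺)^{⌈d_α(s,t)/2⌉}. -/
/-- Partial sums of a sequence that grows by a factor of at most `b` in each step. -/
theorem partial_sum_le_of_growth {b A : ℝ} (hb : 1 < b) (hA : 0 ≤ A) (f S : ℕ → ℝ) (n : ℕ)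
    (hf0 : f 0 ≤ A) (hS0 : S 0 ≤ A) (hf : ∀ i < n, f (i + 1) ≤ b * f i)
    (hS : ∀ i < n, S (i + 1) = S i + f (i + 1)) :
    S n ≤ A * (b / (b - 1)) * b ^ n := by
  have key : ∀ i ≤ n, f i ≤ A * b ^ i ∧ (b - 1) * S i ≤ A * (b ^ (i + 1) - 1) := by
    intro i
    induction i with
    | zero =>
      intro _
      refine ⟨by simpa using hf0, ?_⟩
      have := mul_le_mul_of_nonneg_left hS0 (sub_nonneg.2 hb.le)
      simp only [zero_add, pow_one]
      linarith
    | succ i ih =>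
      intro hi
      obtain ⟨h1, h2⟩ := ih (by omega)
      have h3 : f (i + 1) ≤ A * b ^ (i + 1) := by
        calc f (i + 1) ≤ b * f i := hf i (by omega)
          _ ≤ b * (A * b ^ i) := mul_le_mul_of_nonneg_left h1 (by linarith)
          _ = A * b ^ (i + 1) := by ring
      refine ⟨h3, ?_⟩
      have h4 := mul_le_mul_of_nonneg_left h3 (sub_nonneg.2 hb.le)
      rw [hS i (by omega)]
      calc (b - 1) * (S i + f (i + 1))
          ≤ A * (b ^ (i + 1) - 1) + (b - 1) * (A * b ^ (i + 1)) := by linarith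
        _ = A * (b ^ (i + 1 + 1) - 1) := by ring
  have hpos : 0 < b - 1 := by linarith
  have h : S n * (b - 1) ≤ A * b ^ (n + 1) := by linarith [(key n le_rfl).2]
  calc S n ≤ A * b ^ (n + 1) / (b - 1) := (le_div_iff₀ hpos).2 h
    _ = A * (b / (b - 1)) * b ^ n := by ring


open Finset

/-- meeting in the middle of the relevant distance.
Let `0 ≤ α < 1` and `b⁺ > 1`. Suppose `cheap_s(α) = cs` and `cheap_t(α) = ct` are defined
with `cs < ct`, and `b⁺` is the highest expansion between `s` and `t`. Then there is an
exploration step `k ∈ {0, ..., d(s,t)}` with meeting cost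
`M(k) ≤ 4 · (b⁺/(b⁺-1)) · m^α · (b⁺)^{⌈d_α(s,t)/2⌉}`, where `d_α(s,t) = ct - cs - 1`. -/
theorem stmt_6 {V : Type*} [Fintype V] (G : SimpleGraph V) (s t : V)
    (hconn : G.Connected) (hst : s ≠ t) (α bp : ℝ)
    (hα0 : 0 ≤ α) (hα1 : α < 1) (hbp : 1 < bp) (cs ct : ℕ)
    (hcs : IsCheapS G s t α cs) (hct : IsCheapT G s t α ct) (hlt : cs < ct)
    (hhigh : IsHighestExpansion G s t bp) :
    ∃ k ≤ G.dist s t,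
      (meetCost G s t k : ℝ) ≤
        4 * (bp / (bp - 1)) * (edgeCount G : ℝ) ^ α *
          bp ^ (((ct - cs - 1) + 1) / 2) := by
  obtain ⟨hcs1, hcsd, hcsA, -⟩ := hcs
  obtain ⟨hct1, hctd, hctA, -⟩ := hct
  obtain ⟨⟨hES, hET⟩, -⟩ := hhigh
  set A : ℝ := (edgeCount G : ℝ) ^ α
  have hA : 0 ≤ A := by positivity
  obtain ⟨d, rfl⟩ : ∃ d, ct = cs + d + 1 := ⟨ct - cs - 1, by omega⟩
  have hd : cs + d + 1 - cs - 1 = d := by omega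
  rw [hd]
  have hs : (costSseq G s 1 (cs + d / 2) : ℝ) ≤ A * (bp / (bp - 1)) * bp ^ (d / 2) := by
    refine partial_sum_le_of_growth hbp hA (fun i => (costS G s (cs + i) : ℝ))
      (fun i => (costSseq G s 1 (cs + i) : ℝ)) (d / 2) ?_ hcsA ?_ ?_
    · refine le_trans ?_ hcsA
      exact_mod_cast Finset.single_le_sum (f := costS G s) (fun _ _ => Nat.zero_le _)
        (Finset.mem_Icc.2 ⟨hcs1, le_rfl⟩)
    · exact fun i hi => hES (cs + i) (by omega) (by omega)
    · intro i _
      have : costSseq G s 1 (cs + i + 1) = costSseq G s 1 (cs + i) + costS G s (cs + i + 1) :=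
        Finset.sum_Icc_succ_top (by omega) _
      exact_mod_cast this
  have ht : (costTseq G s t (cs + d + 1 - (d + 1) / 2) (G.dist s t) : ℝ) ≤
      A * (bp / (bp - 1)) * bp ^ ((d + 1) / 2) := by
    refine partial_sum_le_of_growth hbp hA (fun i => (costT G s t (cs + d + 1 - i) : ℝ))
      (fun i => (costTseq G s t (cs + d + 1 - i) (G.dist s t) : ℝ)) ((d + 1) / 2) ?_ hctA ?_ ?_
    · refine le_trans ?_ hctA
      exact_mod_cast Finset.single_le_sum (f := costT G s t) (fun _ _ => Nat.zero_le _)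
        (Finset.mem_Icc.2 ⟨le_rfl, hctd⟩)
    · exact fun i hi => hET (cs + d + 1 - i) (by omega) (by omega)
    · intro i hi
      have hsucc : cs + d + 1 - i = cs + d + 1 - (i + 1) + 1 := by omega
      have : costTseq G s t (cs + d + 1 - (i + 1)) (G.dist s t) =
          costTseq G s t (cs + d + 1 - i) (G.dist s t) + costT G s t (cs + d + 1 - (i + 1)) := by
        have hle : cs + d + 1 - (i + 1) ≤ G.dist s t := by omega
        rw [hsucc, add_comm (costTseq G s t _ _), costTseq, costTseq,
          ← Finset.add_sum_Ioc_eq_sum_Icc (f := costT G s t) hle,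
          Finset.Icc_add_one_left_eq_Ioc]
      exact_mod_cast this
  refine ⟨cs + d / 2, by omega, ?_⟩
  have hk : cs + d / 2 + 1 = cs + d + 1 - (d + 1) / 2 := by omega
  have hC : 0 ≤ A * (bp / (bp - 1)) :=
    mul_nonneg hA (div_nonneg (by linarith) (by linarith))
  have hpow : bp ^ (d / 2) ≤ bp ^ ((d + 1) / 2) := pow_le_pow_right₀ hbp.le (by omega)
  have hmono := mul_le_mul_of_nonneg_left hpow hC
  have hnonneg : 0 ≤ A * (bp / (bp - 1)) * bp ^ ((d + 1) / 2) :=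
    mul_nonneg hC (pow_nonneg (by linarith) _)
  rw [meetCost, hk]
  push_cast
  linarith
end

section
/- For all real constants b > 1, 0 < c ≤ 1, 0 < δ < 1, and b⁺ ≥ b there exists a constant C > 0 with the following property: for every simple, undirected, connected graph G with m edges and all distinct vertices s,t such that s and t admit a b-expansion overlap of size at least c·d(s,t), deg(t) ≤ deg(s) ≤ m^δ, and b⁺ is the highest expansion between s and t, there exists an exploration step k ∈ {0,...,d(s,t)} with meeting cost M(k) ≤ C·m^{1−c(1−δ)/(log_b(b⁺)+c)}. -/
open Finset

theorem sub_one_mul_sum_range_le_of_le_mul {f : ℕ → ℝ} {B D : ℝ} (hB : 1 < B) (hD : 0 ≤ D)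
    (h0 : f 0 ≤ D) (n : ℕ) (hf : ∀ i, i + 1 < n → f (i + 1) ≤ B * f i) :
    (B - 1) * ∑ i ∈ range n, f i ≤ D * B ^ n := by
  have hpt : ∀ i, i < n → f i ≤ D * B ^ i := by
    intro i
    induction i with
    | zero => intro _; simpa using h0
    | succ i ih =>
      intro hi
      calc f (i + 1) ≤ B * f i := hf i hi
        _ ≤ B * (D * B ^ i) := by gcongr; exact ih (by omega)
        _ = D * B ^ (i + 1) := by ring
  calc (B - 1) * ∑ i ∈ range n, f i ≤ (B - 1) * ∑ i ∈ range n, D * B ^ i := by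
        have : 0 ≤ B - 1 := by linarith
        gcongr with i hi
        exact hpt i (mem_range.mp hi)
    _ = D * ((∑ i ∈ range n, B ^ i) * (B - 1)) := by rw [← mul_sum]; ring
    _ = D * (B ^ n - 1) := by rw [geom_sum_mul]
    _ ≤ D * B ^ n := by nlinarith

theorem sub_one_mul_pow_mul_sum_range_le_of_mul_le {f : ℕ → ℝ} {b M : ℝ} (hb : 1 < b)
    (hf0 : ∀ i, 0 ≤ f i) (hM : ∀ i, f i ≤ M) (k n : ℕ)
    (hf : ∀ i, i + 1 < k + n → b * f i ≤ f (i + 1)) :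
    (b - 1) * (b ^ n * ∑ i ∈ range k, f i) ≤ b * M := by
  cases k with
  | zero =>
    have := (hf0 0).trans (hM 0)
    simp only [range_zero, sum_empty, mul_zero]
    positivity
  | succ j =>
    have hsum : ∀ l, l ≤ j → (b - 1) * ∑ i ∈ range (l + 1), f i ≤ b * f l := by
      intro l
      induction l with
      | zero => intro _; have := hf0 0; simp; nlinarith
      | succ l ih =>
        intro hl
        have h1 := ih (by omega)
        have h2 := hf l (by omega)
        rw [sum_range_succ]
        nlinarith
    have hpow : ∀ l, l ≤ n → b ^ l * f j ≤ f (j + l) := by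
      intro l
      induction l with
      | zero => intro _; simp
      | succ l ih =>
        intro hl
        calc b ^ (l + 1) * f j = b * (b ^ l * f j) := by ring
          _ ≤ b * f (j + l) := by gcongr; exact ih (by omega)
          _ ≤ f (j + (l + 1)) := hf (j + l) (by omega)
    calc (b - 1) * (b ^ n * ∑ i ∈ range (j + 1), f i)
        = b ^ n * ((b - 1) * ∑ i ∈ range (j + 1), f i) := by ring
      _ ≤ b ^ n * (b * f j) :=
        mul_le_mul_of_nonneg_left (hsum j le_rfl) (by positivity)
      _ = b * (b ^ n * f j) := by ring
      _ ≤ b * M := by gcongr; exact (hpow n le_rfl).trans (hM _)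

section LayerDegree

variable {V : Type*} [Fintype V]

/-- The sum of the degrees over the layer at distance `i` from `v`. -/
noncomputable def layerDegree (G : SimpleGraph V) (v : V) (i : ℕ) : ℕ :=
  ∑ u ∈ layer G v i, deg G u

theorem layerDegree_le (G : SimpleGraph V) (v : V) (i : ℕ) :
    layerDegree G v i ≤ 2 * edgeCount G := by
  classical
  have hdeg : ∀ u, deg G u = G.degree u := fun u => by
    rw [deg, Nat.card_eq_fintype_card, G.card_neighborSet_eq_degree]
  calc layerDegree G v i ≤ ∑ u, deg G u := sum_le_sum_of_subset (filter_subset _ _)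
    _ = 2 * edgeCount G := by
      simp only [hdeg, G.sum_degrees_eq_twice_card_edges, edgeCount, Nat.card_eq_fintype_card,
        SimpleGraph.edgeFinset_card]

theorem layerDegree_zero {G : SimpleGraph V} (hG : G.Connected) (v : V) :
    layerDegree G v 0 = deg G v := by
  have : layer G v 0 = {v} := by
    ext u
    simp [layer, hG.dist_eq_zero_iff, eq_comm]
  simp [layerDegree, this]

theorem meetCost_eq_sum_layerDegree (G : SimpleGraph V) (s t : V) {k : ℕ}
    (hk : k ≤ G.dist s t) :
    meetCost G s t k =
      ∑ i ∈ range k, layerDegree G s i + ∑ i ∈ range (G.dist s t - k), layerDegree G t i := by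
  unfold meetCost
  congr 1
  · refine sum_nbij' (fun i => i - 1) (fun i => i + 1) ?_ ?_ ?_ ?_ ?_
    all_goals intro i hi
    all_goals simp only [mem_Icc, mem_range] at hi ⊢
    all_goals first | omega | rfl
  · refine sum_nbij' (fun i => G.dist s t - i) (fun i => G.dist s t - i) ?_ ?_ ?_ ?_ ?_
    all_goals intro i hi
    all_goals simp only [mem_Icc, mem_range] at hi ⊢
    all_goals first | omega | rfl

theorem ExpandS.mul_layerDegree_le {G : SimpleGraph V} {s : V} {b : ℝ} {e : ℕ}
    (h : ExpandS G s b 1 e) {i : ℕ} (hi : i + 1 < e) :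
    b * (layerDegree G s i : ℝ) ≤ layerDegree G s (i + 1) :=
  h (i + 1) (by omega) hi

theorem ExpandT.mul_layerDegree_le {G : SimpleGraph V} {s t : V} {b : ℝ} {e : ℕ}
    (h : ExpandT G s t b e (G.dist s t)) {i : ℕ} (hi : e + i < G.dist s t) :
    b * (layerDegree G t i : ℝ) ≤ layerDegree G t (i + 1) := by
  have := h (G.dist s t - i) (by omega) (by omega)
  unfold costT at this
  rwa [show G.dist s t - (G.dist s t - i) = i by omega,
    show G.dist s t - (G.dist s t - i - 1) = i + 1 by omega] at this

theorem ExpBound.layerDegree_left_le {G : SimpleGraph V} {s t : V} {B : ℝ}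
    (h : ExpBound G s t B) {i : ℕ} (hi : i + 1 < G.dist s t) :
    (layerDegree G s (i + 1) : ℝ) ≤ B * layerDegree G s i :=
  h.1 (i + 1) (by omega) hi

theorem ExpBound.layerDegree_right_le {G : SimpleGraph V} {s t : V} {B : ℝ}
    (h : ExpBound G s t B) {i : ℕ} (hi : i + 1 < G.dist s t) :
    (layerDegree G t (i + 1) : ℝ) ≤ B * layerDegree G t i := by
  have := h.2 (G.dist s t - i) (by omega) (by omega)
  unfold costT at this
  rwa [show G.dist s t - (G.dist s t - i) = i by omega,
    show G.dist s t - (G.dist s t - i - 1) = i + 1 by omega] at this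

theorem edgeCount_pos {G : SimpleGraph V} (hG : G.Connected) {s t : V} (hst : s ≠ t) :
    0 < edgeCount G := by
  have : Nontrivial V := ⟨s, t, hst⟩
  obtain ⟨u, hu⟩ := hG.preconnected.exists_adj_of_nontrivial s
  have : Nonempty G.edgeSet := ⟨⟨s(s, u), hu⟩⟩
  exact Nat.card_pos

/-- Meeting in the middle of the overlap costs at most a `b ^ (c * d / 2)` fraction of `m`. -/
theorem exists_meetCost_le_of_overlap {b c : ℝ} (hb : 1 < b) {G : SimpleGraph V} {s t : V}
    {es et : ℕ} (hes : IsExpanS G s t b es) (het : IsExpanT G s t b et) (hle : et ≤ es)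
    (hsize : c * (G.dist s t : ℝ) ≤ (es : ℝ) - (et : ℝ) + 1) :
    ∃ k ≤ G.dist s t,
      (meetCost G s t k : ℝ) * b ^ (c * ((G.dist s t : ℝ) / 2)) ≤
        4 * b ^ 2 / (b - 1) * edgeCount G := by
  obtain ⟨-, hesd, hexpS, -⟩ := hes
  obtain ⟨het1, hetd, hexpT, -⟩ := het
  have hb0 : 0 < b := by linarith
  have hb1 : 0 < b - 1 := by linarith
  have key : ∀ {v : V} (k n : ℕ), c * (G.dist s t : ℝ) ≤ 2 * (n + 1) →
      (∀ i, i + 1 < k + n → b * (layerDegree G v i : ℝ) ≤ layerDegree G v (i + 1)) →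
      (∑ i ∈ range k, (layerDegree G v i : ℝ)) * b ^ (c * ((G.dist s t : ℝ) / 2)) ≤
        2 * b ^ 2 / (b - 1) * edgeCount G := by
    intro v k n hn hf
    have h := sub_one_mul_pow_mul_sum_range_le_of_mul_le hb (fun i => Nat.cast_nonneg _)
      (fun i => (by exact_mod_cast layerDegree_le G v i :
        (layerDegree G v i : ℝ) ≤ 2 * edgeCount G)) k n hf
    have hpow : b ^ (c * ((G.dist s t : ℝ) / 2)) ≤ b ^ (n + 1) := by
      rw [← Real.rpow_natCast]
      exact Real.rpow_le_rpow_of_exponent_le hb.le (by push_cast; linarith)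
    have hS : 0 ≤ ∑ i ∈ range k, (layerDegree G v i : ℝ) := sum_nonneg fun i _ => Nat.cast_nonneg _
    rw [div_mul_eq_mul_div, le_div_iff₀ hb1]
    calc _ ≤ (∑ i ∈ range k, (layerDegree G v i : ℝ)) * b ^ (n + 1) * (b - 1) := by gcongr
      _ = b * ((b - 1) * (b ^ n * ∑ i ∈ range k, (layerDegree G v i : ℝ))) := by ring
      _ ≤ b * (b * (2 * edgeCount G)) := by gcongr
      _ = _ := by ring
  have hk : (es + et) / 2 ≤ G.dist s t := by omega
  refine ⟨(es + et) / 2, hk, ?_⟩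
  rw [meetCost_eq_sum_layerDegree G s t hk]
  have h1 := key (v := s) ((es + et) / 2) (es - (es + et) / 2) (by
    have : es + 1 ≤ et + 2 * (es - (es + et) / 2 + 1) := by omega
    have : (es : ℝ) + 1 ≤ et + 2 * ((es - (es + et) / 2 : ℕ) + 1) := by exact_mod_cast this
    linarith) fun i hi => hexpS.mul_layerDegree_le (by omega)
  have h2 := key (v := t) (G.dist s t - (es + et) / 2) ((es + et) / 2 + 1 - et) (by
    have : es + 1 ≤ et + 2 * ((es + et) / 2 + 1 - et + 1) := by omega
    have : (es : ℝ) + 1 ≤ et + 2 * (((es + et) / 2 + 1 - et : ℕ) + 1) := by exact_mod_cast this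
    linarith) fun i hi => hexpT.mul_layerDegree_le (by omega)
  push_cast
  rw [add_mul]
  calc _ ≤ _ := add_le_add h1 h2
    _ = _ := by ring

/-- Meeting halfway costs at most `B ^ (d / 2)` times the larger of the two degrees. -/
theorem exists_meetCost_le_of_expBound {B D : ℝ} (hB : 1 < B) {G : SimpleGraph V} {s t : V}
    (hG : G.Connected) (hs : (deg G s : ℝ) ≤ D) (ht : (deg G t : ℝ) ≤ D)
    (h : ExpBound G s t B) :
    ∃ k ≤ G.dist s t,
      (meetCost G s t k : ℝ) ≤ 2 * B / (B - 1) * (D * B ^ ((G.dist s t : ℝ) / 2)) := by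
  have hB0 : 0 < B := by linarith
  have hB1 : 0 < B - 1 := by linarith
  have hD : 0 ≤ D := (Nat.cast_nonneg _).trans hs
  have key : ∀ {v : V} (n : ℕ), (deg G v : ℝ) ≤ D → n ≤ G.dist s t → 2 * n ≤ G.dist s t + 2 →
      (∀ i, i + 1 < G.dist s t → (layerDegree G v (i + 1) : ℝ) ≤ B * layerDegree G v i) →
      (∑ i ∈ range n, (layerDegree G v i : ℝ)) ≤
        B / (B - 1) * (D * B ^ ((G.dist s t : ℝ) / 2)) := by
    intro v n hv hnd hn hf
    have h := sub_one_mul_sum_range_le_of_le_mul (f := fun i => (layerDegree G v i : ℝ)) hB hD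
      (by simpa only [layerDegree_zero hG] using hv) n fun i hi => hf i (by omega)
    have hn' : (2 : ℝ) * n ≤ G.dist s t + 2 := by exact_mod_cast hn
    have hpow : B ^ n ≤ B ^ ((G.dist s t : ℝ) / 2) * B := by
      rw [← Real.rpow_natCast, ← Real.rpow_add_one hB0.ne']
      exact Real.rpow_le_rpow_of_exponent_le hB.le (by linarith)
    rw [div_mul_eq_mul_div, le_div_iff₀ hB1, mul_comm]
    calc _ ≤ D * B ^ n := h
      _ ≤ D * (B ^ ((G.dist s t : ℝ) / 2) * B) := by gcongr
      _ = _ := by ring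
  have hk : G.dist s t / 2 ≤ G.dist s t := by omega
  refine ⟨G.dist s t / 2, hk, ?_⟩
  rw [meetCost_eq_sum_layerDegree G s t hk]
  have h1 := key (v := s) (G.dist s t / 2) hs hk (by omega) fun i hi => h.layerDegree_left_le hi
  have h2 := key (v := t) (G.dist s t - G.dist s t / 2) ht (by omega) (by omega)
    fun i hi => h.layerDegree_right_le hi
  push_cast
  calc _ ≤ _ := add_le_add h1 h2
    _ = _ := by ring

end LayerDegree

/-- Corollary 7: expansion overlap and polynomial degree.
For all constants `b > 1`, `0 < c ≤ 1`, `0 < δ < 1`, `b⁺ ≥ b` there is a constant `C > 0`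
such that for every connected graph `G` and all distinct `s, t` admitting a `b`-expansion
overlap of size at least `c · d(s,t)` with `deg(t) ≤ deg(s) ≤ m^δ` and highest expansion
`b⁺`, some exploration step `k ∈ {0, ..., d(s,t)}` has meeting cost
`M(k) ≤ C · m^{1 - c(1-δ)/(log_b(b⁺) + c)}`. -/
theorem stmt_8 (b c δ bp : ℝ) (hb : 1 < b) (hc0 : 0 < c) (hc1 : c ≤ 1)
    (hδ0 : 0 < δ) (hδ1 : δ < 1) (hbp : b ≤ bp) :
    ∃ C : ℝ, 0 < C ∧
      ∀ (V : Type) [Fintype V] (G : SimpleGraph V) (s t : V),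
        G.Connected → s ≠ t →
        ∀ es et : ℕ, IsExpanS G s t b es → IsExpanT G s t b et → et ≤ es →
          c * (G.dist s t : ℝ) ≤ (es : ℝ) - (et : ℝ) + 1 →
          deg G t ≤ deg G s →
          (deg G s : ℝ) ≤ (edgeCount G : ℝ) ^ δ →
          IsHighestExpansion G s t bp →
          ∃ k ≤ G.dist s t,
            (meetCost G s t k : ℝ) ≤
              C * (edgeCount G : ℝ) ^ (1 - c * (1 - δ) / (Real.logb b bp + c)) := by
  have hb0 : 0 < b := by linarith
  have hb1 : 0 < b - 1 := by linarith
  have hbp1 : 0 < bp - 1 := by linarith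
  have hbp0 : 0 < bp := by linarith
  have hlam : 0 ≤ Real.logb b bp := Real.logb_nonneg hb (by linarith)
  have hpow : b ^ Real.logb b bp = bp := Real.rpow_logb hb0 hb.ne' hbp0
  set lam := Real.logb b bp
  have hden : 0 < lam + c := by linarith
  set x := (1 - δ) / (lam + c) with hx
  have hexp : 1 - c * (1 - δ) / (lam + c) = 1 - c * x := by rw [hx, mul_div_assoc]
  have hexp' : δ + x * lam = 1 - c * x := by rw [hx]; field_simp; ring
  have hC1 : 0 < 4 * b ^ 2 / (b - 1) := by positivity
  have hC2 : 0 < 2 * bp / (bp - 1) := by positivity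
  rw [hexp]
  refine ⟨4 * b ^ 2 / (b - 1) + 2 * bp / (bp - 1), by positivity, ?_⟩
  intro V _ G s t hG hst es et hes het hle hsize hdeg hdegm hB
  have hm : 0 < (edgeCount G : ℝ) := by exact_mod_cast edgeCount_pos hG hst
  set m : ℝ := (edgeCount G : ℝ)
  rcases le_total (m ^ x) (b ^ ((G.dist s t : ℝ) / 2)) with hcase | hcase
  · obtain ⟨k, hk, hcost⟩ := exists_meetCost_le_of_overlap hb hes het hle hsize
    refine ⟨k, hk, ?_⟩
    have hmc : m ^ (c * x) ≤ b ^ (c * ((G.dist s t : ℝ) / 2)) := by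
      rw [mul_comm c, mul_comm c, Real.rpow_mul hm.le, Real.rpow_mul hb0.le]
      exact Real.rpow_le_rpow (by positivity) hcase hc0.le
    have : (meetCost G s t k : ℝ) ≤ 4 * b ^ 2 / (b - 1) * m ^ (1 - c * x) := by
      rw [Real.rpow_sub hm, Real.rpow_one, ← mul_div_assoc, le_div_iff₀ (by positivity)]
      exact (mul_le_mul_of_nonneg_left hmc (Nat.cast_nonneg _)).trans hcost
    refine this.trans ?_
    gcongr
    linarith
  · obtain ⟨k, hk, hcost⟩ := exists_meetCost_le_of_expBound (hb.trans_le hbp) hG hdegm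
      ((Nat.cast_le.mpr hdeg).trans hdegm) hB.1
    refine ⟨k, hk, hcost.trans ?_⟩
    have hbd : bp ^ ((G.dist s t : ℝ) / 2) ≤ m ^ (x * lam) := by
      rw [← hpow, ← Real.rpow_mul hb0.le, mul_comm lam, Real.rpow_mul hb0.le, Real.rpow_mul hm.le]
      exact Real.rpow_le_rpow (by positivity) hcase hlam
    have : m ^ δ * bp ^ ((G.dist s t : ℝ) / 2) ≤ m ^ (1 - c * x) := by
      rw [← hexp', Real.rpow_add hm]
      gcongr
    gcongr
    linarith
end

section
/- For all real constants 0 ≤ α < 1, b > 1, b⁺ ≥ b, and ρ₀ with 0 ≤ ρ₀ < (1−α)/(1−α+α·log_b(b⁺)), there exist constants c > 0, k₀ ≥ 0, and x < 1 with the following property: for every simple, undirected, connected graph G with m edges and all distinct vertices s,t such that cheap_s(α), cheap_t(α), expan_s(b), expan_t(b) are defined, b⁺ is the highest expansion between s and t, ρ_{s,t}(α,b) ≤ ρ₀, and expan_s(b) − expan_t(b) + 1 < c·log_b(m) − k₀, it holds that c_s([1, cheap_s(α)+T₂]) ≤ 2^{1−α}·m^x and c_t([cheap_t(α)−S₂,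 d(s,t)]) ≤ 2^{1−α}·m^x. -/
open Finset

theorem sum_Icc_le_geometric {f : ℕ → ℕ} {q A : ℝ} {a N : ℕ} (hq : 1 < q) (ha : 1 ≤ a)
    (hgrow : ∀ k, 1 ≤ k → k + 1 ≤ N → (f (k + 1) : ℝ) ≤ q * f k)
    (hA : ((∑ k ∈ Finset.Icc 1 a, f k : ℕ) : ℝ) ≤ A) (j : ℕ) (hj : a + j ≤ N) :
    ((∑ k ∈ Finset.Icc 1 (a + j), f k : ℕ) : ℝ) ≤ A * (q ^ (j + 1) / (q - 1)) := by
  have key : ∀ j, a + j ≤ N → (f (a + j) : ℝ) ≤ A * q ^ j ∧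
      ((∑ k ∈ Finset.Icc 1 (a + j), f k : ℕ) : ℝ) * (q - 1) ≤ A * (q ^ (j + 1) - 1) := by
    intro j
    induction j with
    | zero =>
      intro _
      have hfa : f a ≤ ∑ k ∈ Finset.Icc 1 a, f k :=
        Finset.single_le_sum (f := f) (fun _ _ => Nat.zero_le _) (Finset.mem_Icc.2 ⟨ha, le_rfl⟩)
      have hfa' : (f a : ℝ) ≤ ((∑ k ∈ Finset.Icc 1 a, f k : ℕ) : ℝ) := by exact_mod_cast hfa
      refine ⟨by simpa using hfa'.trans hA, ?_⟩
      simpa using mul_le_mul_of_nonneg_right hA (sub_nonneg.2 hq.le)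
    | succ j ih =>
      intro hj
      obtain ⟨h1, h2⟩ := ih (by omega)
      have h3 : (f (a + (j + 1)) : ℝ) ≤ A * q ^ (j + 1) := by
        have h := hgrow (a + j) (by omega) (by omega)
        calc (f (a + (j + 1)) : ℝ) ≤ q * f (a + j) := h
          _ ≤ q * (A * q ^ j) := by gcongr
          _ = A * q ^ (j + 1) := by ring
      refine ⟨h3, ?_⟩
      rw [← add_assoc, Finset.sum_Icc_succ_top (by omega), Nat.cast_add]
      have h4 := mul_le_mul_of_nonneg_right h3 (sub_nonneg.2 hq.le)
      calc _ = ((∑ k ∈ Finset.Icc 1 (a + j), f k : ℕ) : ℝ) * (q - 1)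
            + (f (a + (j + 1)) : ℝ) * (q - 1) := by rw [← add_assoc]; ring
        _ ≤ A * (q ^ (j + 1) - 1) + A * q ^ (j + 1) * (q - 1) := add_le_add h2 h4
        _ = _ := by ring
  have hA0 : 0 ≤ A := (Nat.cast_nonneg _).trans hA
  rw [← mul_div_assoc, le_div_iff₀ (sub_pos.2 hq)]
  refine (key j hj).2.trans ?_
  gcongr
  linarith

theorem pow_le_of_expanding {f : ℕ → ℕ} {b : ℝ} {e : ℕ} (hb : 0 ≤ b) (hf : 1 ≤ f 1)
    (hexp : ∀ k, 1 ≤ k → k < e → b * (f k : ℝ) ≤ f (k + 1)) (j : ℕ) (hj : j + 1 ≤ e) :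
    b ^ j ≤ (f (j + 1) : ℝ) := by
  induction j with
  | zero => simpa using hf
  | succ j ih =>
    calc b ^ (j + 1) = b * b ^ j := by ring
      _ ≤ b * f (j + 1) := by gcongr; exact ih (by omega)
      _ ≤ f (j + 1 + 1) := hexp (j + 1) (by omega) (by omega)

/-- An initial segment of an expanding sequence whose total is at most `m ^ α` has length at most
`α * logb b m + 1`. -/
theorem min_le_of_expanding {f : ℕ → ℕ} {α b : ℝ} {m cs es : ℕ} (hb : 1 < b) (hm : 1 ≤ m)
    (hf : 1 ≤ f 1) (hcs : 1 ≤ cs) (hes : 1 ≤ es)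
    (hcheap : ((∑ k ∈ Finset.Icc 1 cs, f k : ℕ) : ℝ) ≤ (m : ℝ) ^ α)
    (hexp : ∀ k, 1 ≤ k → k < es → b * (f k : ℝ) ≤ f (k + 1)) :
    ((min cs es : ℕ) : ℝ) ≤ α * Real.logb b m + 1 := by
  obtain ⟨j, hj⟩ : ∃ j, min cs es = j + 1 := ⟨min cs es - 1, by omega⟩
  have h1 := pow_le_of_expanding (zero_le_one.trans hb.le) hf hexp j (by omega)
  have h2 : f (j + 1) ≤ ∑ k ∈ Finset.Icc 1 cs, f k :=
    Finset.single_le_sum (f := f) (fun _ _ => Nat.zero_le _) (Finset.mem_Icc.2 ⟨by omega, by omega⟩)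
  have h3 : (f (j + 1) : ℝ) ≤ ((∑ k ∈ Finset.Icc 1 cs, f k : ℕ) : ℝ) := by exact_mod_cast h2
  have hm0 : (0 : ℝ) < m := by exact_mod_cast hm
  have h4 := Real.logb_le_logb_of_le hb (pow_pos (zero_lt_one.trans hb) j)
    (h1.trans (h3.trans hcheap))
  rw [Real.logb_pow, Real.logb_self_eq_one hb, Real.logb_rpow_eq_mul_logb_of_pos hm0] at h4
  rw [hj]
  push_cast
  linarith

/-- A sequence of exploration costs that starts with a cheap part and grows at most by the factor
`bp` per step stays small until step `et - 1`. -/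
theorem sum_Icc_le_rpow {f : ℕ → ℕ} {α b bp ρ c : ℝ} {d m cs es et : ℕ}
    (hα0 : 0 ≤ α) (hb : 1 < b) (hbp : b ≤ bp) (hρ0 : 0 ≤ ρ) (hρ1 : ρ < 1) (hc : 0 ≤ c)
    (hm : 1 ≤ m) (hf : 1 ≤ f 1) (hcs : 1 ≤ cs) (hes : 1 ≤ es) (het : et ≤ d)
    (hcheap : ((∑ k ∈ Finset.Icc 1 cs, f k : ℕ) : ℝ) ≤ (m : ℝ) ^ α)
    (hexp : ∀ k, 1 ≤ k → k < es → b * (f k : ℝ) ≤ f (k + 1))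
    (hgrow : ∀ k, 1 ≤ k → k + 1 ≤ d → (f (k + 1) : ℝ) ≤ bp * f k)
    (hρ : (et : ℝ) - cs - 1 ≤ ρ * es)
    (hoverlap : (es : ℝ) - et + 1 ≤ c * Real.logb b m) :
    ((∑ k ∈ Finset.Icc 1 (cs + (et - cs - 1)), f k : ℕ) : ℝ) ≤
      bp / (bp - 1) * bp ^ (ρ / (1 - ρ)) *
        (m : ℝ) ^ (α + Real.logb b bp * (ρ / (1 - ρ)) * (α + c)) := by
  have hbp1 : 1 < bp := hb.trans_le hbp
  have hbp0 : 0 < bp := zero_lt_one.trans hbp1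
  have hb0 : 0 < b := zero_lt_one.trans hb
  have hm1 : (1 : ℝ) ≤ m := by exact_mod_cast hm
  have hm0 : (0 : ℝ) < m := zero_lt_one.trans_le hm1
  set r := ρ / (1 - ρ) with hr
  set l := Real.logb b m with hl
  have hl0 : 0 ≤ l := Real.logb_nonneg hb hm1
  have hρ1' : 0 < 1 - ρ := sub_pos.2 hρ1
  have hr0 : 0 ≤ r := div_nonneg hρ0 hρ1'.le
  have hαc : 0 ≤ (α + c) * l := by positivity
  obtain ⟨T, hT⟩ : ∃ T, T = et - cs - 1 := ⟨_, rfl⟩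
  have hmin := min_le_of_expanding hb hm hf hcs hes hcheap hexp
  have hTr : (T : ℝ) ≤ r * ((α + c) * l + 1) := by
    rcases Nat.eq_zero_or_pos T with h0 | hpos
    · rw [h0, Nat.cast_zero]; positivity
    · have hTe : (T : ℝ) = et - cs - 1 := by
        have : et = T + cs + 1 := by omega
        rw [this]; push_cast; ring
      have hes' : (es : ℝ) ≤ (α + c) * l + 1 + T := by
        rcases le_total es cs with h | h
        · rw [min_eq_right h, ← hl] at hmin
          have : 0 ≤ c * l := by positivity
          have : (0 : ℝ) ≤ T := Nat.cast_nonneg _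
          linarith
        · rw [min_eq_left h, ← hl] at hmin
          linarith
      have h5 : (T : ℝ) ≤ ρ * ((α + c) * l + 1 + T) := by
        rw [hTe] at hes' ⊢
        exact hρ.trans (mul_le_mul_of_nonneg_left hes' hρ0)
      rw [hr, div_mul_eq_mul_div, le_div_iff₀ hρ1']
      linarith
  rw [← hT]
  rcases Nat.eq_zero_or_pos T with h0 | hpos
  · have h1 : 1 ≤ bp / (bp - 1) := by
      rw [le_div_iff₀ (sub_pos.2 hbp1)]; linarith
    have h2 : 1 ≤ bp ^ r := Real.one_le_rpow hbp1.le hr0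
    have hL : 0 ≤ Real.logb b bp := Real.logb_nonneg hb hbp1.le
    have h3 : (m : ℝ) ^ α ≤ (m : ℝ) ^ (α + Real.logb b bp * r * (α + c)) :=
      Real.rpow_le_rpow_of_exponent_le hm1 (le_add_of_nonneg_right (by positivity))
    rw [h0, add_zero]
    refine hcheap.trans (h3.trans (le_mul_of_one_le_left (by positivity) ?_))
    exact one_le_mul_of_one_le_of_one_le h1 h2
  · have h1 := sum_Icc_le_geometric hbp1 hcs hgrow hcheap T (by omega)
    have h2 : bp ^ T ≤ bp ^ r * (m : ℝ) ^ (Real.logb b bp * r * (α + c)) := by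
      have hml : (m : ℝ) = b ^ l := (Real.rpow_logb hb0 hb.ne' hm0).symm
      have hbL : b ^ Real.logb b bp = bp := Real.rpow_logb hb0 hb.ne' hbp0
      calc bp ^ T = bp ^ (T : ℝ) := (Real.rpow_natCast _ _).symm
        _ ≤ bp ^ (r + r * ((α + c) * l)) :=
          Real.rpow_le_rpow_of_exponent_le hbp1.le (by linarith)
        _ = bp ^ r * bp ^ (r * ((α + c) * l)) := Real.rpow_add hbp0 _ _
        _ = bp ^ r * (m : ℝ) ^ (Real.logb b bp * r * (α + c)) := by
          congr 1
          rw [hml, ← Real.rpow_mul hb0.le]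
          nth_rewrite 1 [← hbL]
          rw [← Real.rpow_mul hb0.le]
          congr 1
          ring
    calc _ ≤ (m : ℝ) ^ α * (bp ^ (T + 1) / (bp - 1)) := h1
      _ = bp / (bp - 1) * bp ^ T * (m : ℝ) ^ α := by ring
      _ ≤ bp / (bp - 1) * (bp ^ r * (m : ℝ) ^ (Real.logb b bp * r * (α + c))) * (m : ℝ) ^ α := by
        have : 0 < bp - 1 := sub_pos.2 hbp1
        gcongr
      _ = _ := by rw [Real.rpow_add hm0]; ring

theorem exists_rpow_bound {K y : ℝ} (hy : y < 1) :
    ∃ (x : ℝ) (M : ℕ), x < 1 ∧ 1 ≤ M ∧ ∀ m : ℕ, M ≤ m → K * (m : ℝ) ^ y ≤ (m : ℝ) ^ x := by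
  have h := (tendsto_rpow_atTop (show 0 < (1 - y) / 2 by linarith)).comp
    (tendsto_natCast_atTop_atTop (R := ℝ))
  obtain ⟨M, hM⟩ := Filter.eventually_atTop.1 (h.eventually_ge_atTop K)
  refine ⟨(1 + y) / 2, max M 1, by linarith, le_max_right _ _, fun m hm => ?_⟩
  have hm0 : (0 : ℝ) < m := by exact_mod_cast (le_max_right M 1).trans hm
  have h1 : K ≤ (m : ℝ) ^ ((1 - y) / 2) := hM m ((le_max_left _ _).trans hm)
  calc K * (m : ℝ) ^ y ≤ (m : ℝ) ^ ((1 - y) / 2) * (m : ℝ) ^ y := by gcongr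
    _ = (m : ℝ) ^ ((1 + y) / 2) := by rw [← Real.rpow_add hm0]; congr 1; ring

theorem sum_Icc_reflect (g : ℕ → ℕ) {a d : ℕ} (ha : 1 ≤ a) :
    ∑ k ∈ Finset.Icc a d, g k = ∑ k ∈ Finset.Icc 1 (d + 1 - a), g (d + 1 - k) := by
  refine Finset.sum_bij' (fun k _ => d + 1 - k) (fun k _ => d + 1 - k) ?_ ?_ ?_ ?_ ?_ <;>
    intro k hk <;> rw [Finset.mem_Icc] at hk
  · rw [Finset.mem_Icc]; omega
  · rw [Finset.mem_Icc]; omega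
  · omega
  · omega
  · congr 1; omega

section Graph

variable {V : Type*} [Fintype V] {G : SimpleGraph V}

theorem one_le_deg {u v : V} (hG : G.Connected) (huv : u ≠ v) : 1 ≤ deg G u := by
  have : Nontrivial V := ⟨⟨u, v, huv⟩⟩
  obtain ⟨w, hw⟩ := hG.preconnected.exists_adj_of_nontrivial u
  have : Nonempty (G.neighborSet u) := ⟨⟨w, hw⟩⟩
  exact Nat.card_pos

theorem sum_layer_zero (hG : G.Connected) (v : V) : ∑ u ∈ layer G v 0, deg G u = deg G v := by
  have : layer G v 0 = {v} := by
    ext u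
    simp only [layer, Finset.mem_filter, Finset.mem_univ, true_and, Finset.mem_singleton]
    rw [hG.dist_eq_zero_iff, eq_comm]
  rw [this, Finset.sum_singleton]

theorem dist_le_edgeCount (hG : G.Connected) (s t : V) : G.dist s t ≤ edgeCount G := by
  classical
  obtain ⟨p, hp, hlen⟩ := hG.exists_path_of_dist s t
  rw [← hlen, edgeCount, Nat.card_eq_fintype_card, ← SimpleGraph.edgeFinset_card]
  exact hp.isTrail.length_le_card_edgeFinset

end Graph

/-- Lemma 9: small expansion overlap gives cheap long prefix/suffix.
For all constants `0 ≤ α < 1`, `b > 1`, `b⁺ ≥ b`, `0 ≤ ρ₀ < (1-α)/(1-α+α·log_b(b⁺))`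
there are constants `c > 0`, `k₀ ≥ 0`, `x < 1` such that: whenever `b⁺` is the highest
expansion between `s` and `t`, `ρ_{s,t}(α,b) ≤ ρ₀`, and the overlap size satisfies
`expan_s - expan_t + 1 < c · log_b(m) - k₀`, then
`c_s([1, cheap_s + T₂]) ≤ 2^{1-α} · m^x` and `c_t([cheap_t - S₂, d(s,t)]) ≤ 2^{1-α} · m^x`,
where `T₂ = expan_t - cheap_s - 1` and `S₂ = cheap_t - expan_s - 1`. -/
theorem stmt_10 (α b bp ρ₀ : ℝ) (hα0 : 0 ≤ α) (hα1 : α < 1) (hb : 1 < b)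
    (hbp : b ≤ bp) (hρ0 : 0 ≤ ρ₀)
    (hρ1 : ρ₀ < (1 - α) / (1 - α + α * Real.logb b bp)) :
    ∃ c k₀ x : ℝ, 0 < c ∧ 0 ≤ k₀ ∧ x < 1 ∧
      ∀ (V : Type) [Fintype V] (G : SimpleGraph V) (s t : V),
        G.Connected → s ≠ t →
        ∀ cs ct es et : ℕ, IsCheapS G s t α cs → IsCheapT G s t α ct →
          IsExpanS G s t b es → IsExpanT G s t b et →
          IsHighestExpansion G s t bp →
          rho (G.dist s t) cs ct es et ≤ ρ₀ →
          (es : ℝ) - (et : ℝ) + 1 < c * Real.logb b (edgeCount G : ℝ) - k₀ →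
          (costSseq G s 1 (cs + (et - cs - 1)) : ℝ) ≤
              (2 : ℝ) ^ (1 - α) * (edgeCount G : ℝ) ^ x ∧
            (costTseq G s t (ct - (ct - es - 1)) (G.dist s t) : ℝ) ≤
              (2 : ℝ) ^ (1 - α) * (edgeCount G : ℝ) ^ x := by
  have hL : 0 ≤ Real.logb b bp := Real.logb_nonneg hb (hb.le.trans hbp)
  have hαL : 0 ≤ α * Real.logb b bp := mul_nonneg hα0 hL
  have hden : 0 < 1 - α + α * Real.logb b bp := by linarith
  rw [lt_div_iff₀ hden] at hρ1
  have hρlt : ρ₀ < 1 := by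
    by_contra! h
    have := mul_le_mul_of_nonneg_right h hden.le
    linarith
  have hρ' : 0 < 1 - ρ₀ := sub_pos.2 hρlt
  set r := ρ₀ / (1 - ρ₀) with hr
  have hr0 : 0 ≤ r := div_nonneg hρ0 hρ'.le
  have hgap : 0 < 1 - α - Real.logb b bp * r * α := by
    have : r * (1 - ρ₀) = ρ₀ := div_mul_cancel₀ _ hρ'.ne'
    have h2 : 0 < (1 - α - Real.logb b bp * r * α) * (1 - ρ₀) := by
      have : (1 - α - Real.logb b bp * r * α) * (1 - ρ₀) =
          (1 - α) * (1 - ρ₀) - Real.logb b bp * α * (r * (1 - ρ₀)) := by ring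
      rw [this, ‹r * (1 - ρ₀) = ρ₀›]
      linarith
    exact pos_of_mul_pos_left h2 hρ'.le
  have hLr : 0 ≤ Real.logb b bp * r := mul_nonneg hL hr0
  obtain ⟨c, hc, hy⟩ : ∃ c : ℝ, 0 < c ∧ α + Real.logb b bp * r * (α + c) < 1 := by
    refine ⟨(1 - α - Real.logb b bp * r * α) / (Real.logb b bp * r + 1), by positivity, ?_⟩
    have : Real.logb b bp * r *
        ((1 - α - Real.logb b bp * r * α) / (Real.logb b bp * r + 1)) <
        1 - α - Real.logb b bp * r * α := by
      rw [← mul_div_assoc, div_lt_iff₀ (by positivity)]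
      linarith
    linarith
  obtain ⟨x, M, hx, hM, hbound⟩ := exists_rpow_bound (K := bp / (bp - 1) * bp ^ r) hy
  have hM1 : (1 : ℝ) ≤ M := by exact_mod_cast hM
  have hlM : 0 ≤ Real.logb b M := Real.logb_nonneg hb hM1
  refine ⟨c, M + c * Real.logb b M, x, hc, by positivity, hx, ?_⟩
  intro V _ G s t hG hst cs ct es et hcs hct hes het hhigh hrho hover
  obtain ⟨hcs1, hcsd, hcs2, -⟩ := hcs
  obtain ⟨hct1, hctd, hct2, -⟩ := hct
  obtain ⟨hes1, hesd, hes2, -⟩ := hes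
  obtain ⟨het1, hetd, het2, -⟩ := het
  obtain ⟨⟨hgS, hgT⟩, -⟩ := hhigh
  have hdm := dist_le_edgeCount hG s t
  obtain ⟨d, hd⟩ : ∃ d, d = G.dist s t := ⟨_, rfl⟩
  rw [← hd] at hcsd hctd hct2 hesd hetd het2 hgS hgT hdm hrho ⊢
  obtain ⟨m, hm⟩ : ∃ m, m = edgeCount G := ⟨_, rfl⟩
  rw [← hm] at hcs2 hct2 hdm hover ⊢
  have hm1 : 1 ≤ m := by omega
  have hm0 : (0 : ℝ) < m := by exact_mod_cast hm1
  have hes1' : (1 : ℝ) ≤ es := by exact_mod_cast hes1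
  have hetd' : (et : ℝ) ≤ d := by exact_mod_cast hetd
  have hdm' : (d : ℝ) ≤ m := by exact_mod_cast hdm
  have hMm : M ≤ m := by
    by_contra! h
    have h' : (m : ℝ) ≤ M := by exact_mod_cast h.le
    have := mul_le_mul_of_nonneg_left (Real.logb_le_logb_of_le hb hm0 h') hc.le
    linarith
  have hov : (es : ℝ) - et + 1 ≤ c * Real.logb b m := by
    have : 0 ≤ c * Real.logb b M := by positivity
    linarith
  have hmin : 0 < min (es : ℝ) ((d : ℝ) - et + 1) := lt_min (by linarith) (by linarith)
  rw [rho, div_le_iff₀ hmin] at hrho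
  have hone : (1 : ℝ) ≤ 2 ^ (1 - α) := Real.one_le_rpow one_le_two (by linarith)
  have hfin : bp / (bp - 1) * bp ^ r * (m : ℝ) ^ (α + Real.logb b bp * r * (α + c)) ≤
      2 ^ (1 - α) * (m : ℝ) ^ x :=
    (hbound m hMm).trans (le_mul_of_one_le_left (by positivity) hone)
  constructor
  · refine le_trans ?_ hfin
    refine sum_Icc_le_rpow (d := d) (es := es) hα0 hb hbp hρ0 hρlt hc.le hm1 ?_ hcs1 hes1 hetd hcs2
      hes2 hgS ?_ hov
    · rw [costS, sum_layer_zero hG]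
      exact one_le_deg hG hst
    · exact (le_max_right _ _).trans
        (hrho.trans (mul_le_mul_of_nonneg_left (min_le_left _ _) hρ0))
  · refine le_trans ?_ hfin
    rw [costTseq, sum_Icc_reflect _ (by omega)] at hct2 ⊢
    have hidx : d + 1 - (ct - (ct - es - 1)) =
        (d + 1 - ct) + ((d + 1 - es) - (d + 1 - ct) - 1) := by omega
    rw [hidx]
    refine sum_Icc_le_rpow (f := fun k => costT G s t (d + 1 - k)) (d := d) (es := d + 1 - et)
      hα0 hb hbp hρ0 hρlt hc.le hm1 ?_ (by omega) (by omega) (by omega) hct2 ?_ ?_ ?_ ?_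
    · have : G.dist s t - (d + 1 - 1) = 0 := by omega
      simp only [costT]
      rw [this, sum_layer_zero hG]
      exact one_le_deg hG hst.symm
    · intro k hk1 hk2
      have := het2 (d + 1 - k) (by omega) (by omega)
      rwa [show d + 1 - k - 1 = d + 1 - (k + 1) by omega] at this
    · intro k hk1 hk2
      have := hgT (d + 1 - k) (by omega) (by omega)
      rwa [show d + 1 - k - 1 = d + 1 - (k + 1) by omega] at this
    · rw [Nat.cast_sub (by omega), Nat.cast_sub (by omega), Nat.cast_sub (by omega)]
      push_cast
      have h1 := (le_max_left _ _).trans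
        (hrho.trans (mul_le_mul_of_nonneg_left (min_le_right _ _) hρ0))
      calc _ = (ct : ℝ) - es - 1 := by ring
        _ ≤ ρ₀ * ((d : ℝ) - et + 1) := h1
        _ = _ := by ring
    · rw [Nat.cast_sub (by omega), Nat.cast_sub (by omega)]
      push_cast
      linarith
end
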